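/- There exists a unique c in the interval [2/√3, e^{0.15325}] such that h₁(c) + 3·h₂(c) = π, where h₁(c) = ∫_{π/3}^{2π/3} (1 − R⁻(c·sin ψ)²)⁻¹ dψ and h₂(c) = ∫_{R⁻((√3/2)c)}^{R⁺((√3/2)c)} K(R)/(R·√(c² − K(R)²)) dR. (This is the analytic content of the existence and uniqueness of the degenerate 4-cell shrinker of type AA → BA → BC: h₁ + 3h₂ is increasing on this interval, with value h₁(2/√3) < π at the left endpoint and value exceeding π at the right endpoint.) -/

import Mathlib

open Real

noncomputable def K (R : ℝ) : ℝ := Real.exp ((R ^ 2 - 1) / 2) / R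

section

open Set MeasureTheory Filter Topology

/-- The logarithm of `K` in the logarithmic coordinate `s = log R`. -/
noncomputable def logK (s : ℝ) : ℝ := (exp (2 * s) - 1) / 2 - s

lemma logK_zero : logK 0 = 0 := by simp [logK]

lemma hasDerivAt_logK (s : ℝ) : HasDerivAt logK (exp (2 * s) - 1) s := by
  have h : HasDerivAt (fun s : ℝ => exp (2 * s)) (exp (2 * s) * (2 * 1)) s :=
    ((hasDerivAt_id s).const_mul 2).exp
  rw [show exp (2 * s) - 1 = exp (2 * s) * (2 * 1) / 2 - 1 by ring]
  exact ((h.sub_const 1).div_const 2).sub (hasDerivAt_id s)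

lemma continuous_logK : Continuous logK := by
  unfold logK
  fun_prop

lemma strictAntiOn_logK : StrictAntiOn logK (Iic 0) := by
  refine strictAntiOn_of_deriv_neg (convex_Iic 0) continuous_logK.continuousOn fun s hs => ?_
  rw [interior_Iic] at hs
  rw [(hasDerivAt_logK s).deriv]
  have : exp (2 * s) < 1 := by
    rw [exp_lt_one_iff]
    linarith [mem_Iio.1 hs]
  linarith

lemma strictMonoOn_logK : StrictMonoOn logK (Ici 0) := by
  refine strictMonoOn_of_deriv_pos (convex_Ici 0) continuous_logK.continuousOn fun s hs => ?_
  rw [interior_Ici] at hs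
  rw [(hasDerivAt_logK s).deriv]
  have : 1 < exp (2 * s) := by
    rw [one_lt_exp_iff]
    linarith [mem_Ioi.1 hs]
  linarith

lemma logK_nonneg (s : ℝ) : 0 ≤ logK s := by
  have := add_one_le_exp (2 * s)
  unfold logK
  linarith

/-- `P` is the nonpositive inverse branch of `logK` on `[0, ∞)`. -/
def IsNegBranch (P : ℝ → ℝ) : Prop := ∀ y, 0 ≤ y → P y ≤ 0 ∧ logK (P y) = y

/-- `N` is the nonnegative inverse branch of `logK` on `[0, ∞)`. -/
def IsPosBranch (N : ℝ → ℝ) : Prop := ∀ y, 0 ≤ y → 0 ≤ N y ∧ logK (N y) = y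

lemma MonotoneOn.continuousOn_Ici_of_surjOn {f : ℝ → ℝ} (hf : MonotoneOn f (Ici 0))
    (hmaps : MapsTo f (Ici 0) (Ici 0)) (hsurj : SurjOn f (Ici 0) (Ici 0)) :
    ContinuousOn f (Ici 0) := by
  have hmono : Monotone fun y => if 0 ≤ y then f y else y := by
    intro a b hab
    dsimp only
    split_ifs with h1 h2 h2
    · exact hf h1 h2 hab
    · linarith
    · have := hmaps (mem_Ici.2 h2)
      rw [mem_Ici] at this
      linarith
    · exact hab
  have hcont : Continuous fun y => if 0 ≤ y then f y else y := by
    refine hmono.continuous_of_surjective fun z => ?_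
    rcases le_or_gt 0 z with hz | hz
    · obtain ⟨y, hy, rfl⟩ := hsurj (mem_Ici.2 hz)
      exact ⟨y, if_pos hy⟩
    · exact ⟨z, if_neg (not_le.2 hz)⟩
  exact hcont.continuousOn.congr fun y hy => (if_pos (mem_Ici.1 hy)).symm

namespace IsPosBranch

variable {N : ℝ → ℝ}

lemma apply_logK (hN : IsPosBranch N) {s : ℝ} (hs : 0 ≤ s) : N (logK s) = s :=
  have h := hN _ (logK_nonneg s)
  strictMonoOn_logK.injOn h.1 hs h.2

lemma apply_zero (hN : IsPosBranch N) : N 0 = 0 := by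
  simpa [logK_zero] using hN.apply_logK le_rfl

lemma lt_iff (hN : IsPosBranch N) {y s : ℝ} (hy : 0 ≤ y) (hs : 0 ≤ s) : N y < s ↔ y < logK s := by
  rw [← strictMonoOn_logK.lt_iff_lt (hN y hy).1 hs, (hN y hy).2]

lemma le_iff (hN : IsPosBranch N) {y s : ℝ} (hy : 0 ≤ y) (hs : 0 ≤ s) : s ≤ N y ↔ logK s ≤ y := by
  rw [← strictMonoOn_logK.le_iff_le hs (hN y hy).1, (hN y hy).2]

lemma strictMonoOn (hN : IsPosBranch N) : StrictMonoOn N (Ici 0) := fun y hy z hz h => by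
  rwa [hN.lt_iff hy (hN z hz).1, (hN z hz).2]

lemma continuousOn (hN : IsPosBranch N) : ContinuousOn N (Ici 0) :=
  hN.strictMonoOn.monotoneOn.continuousOn_Ici_of_surjOn (fun y hy => (hN y hy).1)
    fun s hs => ⟨logK s, logK_nonneg s, hN.apply_logK hs⟩

lemma pos (hN : IsPosBranch N) {y : ℝ} (hy : 0 < y) : 0 < N y := by
  simpa [hN.apply_zero] using hN.strictMonoOn (mem_Ici.2 le_rfl) hy.le hy

lemma hasDerivAt (hN : IsPosBranch N) {y : ℝ} (hy : 0 < y) :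
    HasDerivAt N (exp (2 * N y) - 1)⁻¹ y := by
  refine HasDerivAt.of_local_left_inverse (hN.continuousOn.continuousAt (Ici_mem_nhds hy))
    (hasDerivAt_logK _) ?_ ?_
  · have : 1 < exp (2 * N y) := by
      rw [one_lt_exp_iff]
      linarith [hN.pos hy]
    linarith
  · filter_upwards [lt_mem_nhds hy] with z hz using (hN z hz.le).2

end IsPosBranch

namespace IsNegBranch

variable {P : ℝ → ℝ}

lemma apply_logK (hP : IsNegBranch P) {s : ℝ} (hs : s ≤ 0) : P (logK s) = s :=
  have h := hP _ (logK_nonneg s)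
  strictAntiOn_logK.injOn h.1 hs h.2

lemma apply_zero (hP : IsNegBranch P) : P 0 = 0 := by
  simpa [logK_zero] using hP.apply_logK le_rfl

lemma lt_iff (hP : IsNegBranch P) {y s : ℝ} (hy : 0 ≤ y) (hs : s ≤ 0) : s < P y ↔ y < logK s := by
  rw [← strictAntiOn_logK.lt_iff_gt (hP y hy).1 hs, (hP y hy).2]

lemma le_iff (hP : IsNegBranch P) {y s : ℝ} (hy : 0 ≤ y) (hs : s ≤ 0) : P y ≤ s ↔ logK s ≤ y := by
  rw [← strictAntiOn_logK.le_iff_ge hs (hP y hy).1, (hP y hy).2]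

lemma strictAntiOn (hP : IsNegBranch P) : StrictAntiOn P (Ici 0) := fun y hy z hz h => by
  rwa [hP.lt_iff hy (hP z hz).1, (hP z hz).2]

lemma continuousOn (hP : IsNegBranch P) : ContinuousOn P (Ici 0) := by
  have h : ContinuousOn (fun y => -P y) (Ici 0) := by
    refine MonotoneOn.continuousOn_Ici_of_surjOn
      (fun y hy z hz h => neg_le_neg (hP.strictAntiOn.antitoneOn hy hz h))
      (fun y hy => mem_Ici.2 (neg_nonneg.2 (hP y hy).1)) fun s hs => ?_
    refine ⟨logK (-s), logK_nonneg _, ?_⟩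
    dsimp only
    rw [hP.apply_logK (neg_nonpos.2 hs), neg_neg]
  exact h.neg.congr fun y _ => (neg_neg _).symm

lemma neg (hP : IsNegBranch P) {y : ℝ} (hy : 0 < y) : P y < 0 := by
  simpa [hP.apply_zero] using hP.strictAntiOn (mem_Ici.2 le_rfl) hy.le hy

lemma exp_lt_one (hP : IsNegBranch P) {y : ℝ} (hy : 0 < y) : exp (2 * P y) < 1 := by
  rw [exp_lt_one_iff]
  linarith [hP.neg hy]

lemma hasDerivAt (hP : IsNegBranch P) {y : ℝ} (hy : 0 < y) :
    HasDerivAt P (-(1 - exp (2 * P y))⁻¹) y := by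
  have h1 := hP.exp_lt_one hy
  rw [neg_inv, neg_sub]
  refine HasDerivAt.of_local_left_inverse (hP.continuousOn.continuousAt (Ici_mem_nhds hy))
    (hasDerivAt_logK _) (by linarith) ?_
  filter_upwards [lt_mem_nhds hy] with z hz using (hP z hz.le).2

end IsNegBranch

/-- The angular speed `1 / (1 - R²)` along the negative branch, with `R = exp (P y)`. -/
noncomputable def speed (P : ℝ → ℝ) (y : ℝ) : ℝ := (1 - exp (2 * P y))⁻¹

namespace IsNegBranch

variable {P : ℝ → ℝ}

lemma speed_pos (hP : IsNegBranch P) {y : ℝ} (hy : 0 < y) : 0 < speed P y :=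
  inv_pos.2 (by linarith [hP.exp_lt_one hy])

lemma speed_nonneg (hP : IsNegBranch P) {y : ℝ} (hy : 0 ≤ y) : 0 ≤ speed P y := by
  rcases hy.eq_or_lt with rfl | hy
  · simp [speed, hP.apply_zero]
  · exact (hP.speed_pos hy).le

lemma speed_anti (hP : IsNegBranch P) {y z : ℝ} (hy : 0 < y) (hyz : y ≤ z) :
    speed P z ≤ speed P y := by
  have h1 := hP.exp_lt_one hy
  have h2 := hP.strictAntiOn.antitoneOn hy.le (hy.le.trans hyz) hyz
  refine inv_anti₀ (by linarith) ?_
  have : exp (2 * P z) ≤ exp (2 * P y) := by gcongr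
  linarith

lemma continuousOn_speed (hP : IsNegBranch P) : ContinuousOn (speed P) (Ioi 0) := by
  refine ContinuousOn.inv₀ ?_ fun y hy => by linarith [hP.exp_lt_one hy]
  have := hP.continuousOn.mono Ioi_subset_Ici_self
  fun_prop

/-- The tangent line inequality for `speed` at the point where `1 - R² = d`. -/
lemma tangent_le_speed (hP : IsNegBranch P) {d y : ℝ} (hd : 0 < d) (hd1 : d < 1) (hy : 0 < y) :
    1 / d + 2 * (1 - d) / d ^ 3 * ((-d - log (1 - d)) / 2 - y) ≤ speed P y := by
  have h1 := hP.exp_lt_one hy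
  have hy2 := (hP y hy.le).2
  unfold logK at hy2
  unfold speed
  set e := 1 - exp (2 * P y) with he
  have he0 : 0 < e := by linarith
  have he1 : 0 < 1 - e := by rw [he]; linarith [exp_pos (2 * P y)]
  have hlog : log (1 - e) = 2 * P y := by rw [he, sub_sub_cancel, log_exp]
  have hd1' : 0 < 1 - d := by linarith
  have hl : 1 - ((1 - d) / (1 - e))⁻¹ ≤ log ((1 - d) / (1 - e)) :=
    one_sub_inv_le_log_of_pos (by positivity)
  rw [log_div hd1'.ne' he1.ne', inv_div, hlog] at hl
  have hyd : (-d - log (1 - d)) / 2 - y ≤ (e - d + ((1 - e) / (1 - d) - 1)) / 2 := by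
    have : exp (2 * P y) = 1 - e := by rw [he]; ring
    rw [this] at hy2
    linarith
  calc 1 / d + 2 * (1 - d) / d ^ 3 * ((-d - log (1 - d)) / 2 - y)
      ≤ 1 / d + 2 * (1 - d) / d ^ 3 * ((e - d + ((1 - e) / (1 - d) - 1)) / 2) := by gcongr
    _ = e⁻¹ - (e - d) ^ 2 / (e * d ^ 2) := by
      field_simp
      ring
    _ ≤ e⁻¹ := by
      have : 0 ≤ (e - d) ^ 2 / (e * d ^ 2) := by positivity
      linarith

lemma convexOn_speed (hP : IsNegBranch P) : ConvexOn ℝ (Ioi 0) (speed P) := by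
  refine ⟨convex_Ioi 0, fun x hx y hy a b ha hb hab => ?_⟩
  simp only [smul_eq_mul]
  have hz : 0 < a * x + b * y := by
    have := convex_Ioi (0 : ℝ) hx hy ha hb hab
    simpa using this
  have h1 := hP.exp_lt_one hz
  have hz2 := (hP _ hz.le).2
  set z := a * x + b * y with hzdef
  have hd1 : 1 - exp (2 * P z) < 1 := by linarith [exp_pos (2 * P z)]
  have hd0 : 0 < 1 - exp (2 * P z) := by linarith
  have hzeq : (-(1 - exp (2 * P z)) - log (1 - (1 - exp (2 * P z)))) / 2 = z := by
    rw [sub_sub_cancel, log_exp]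
    unfold logK at hz2
    linarith
  have tx := hP.tangent_le_speed hd0 hd1 hx
  have ty := hP.tangent_le_speed hd0 hd1 hy
  rw [hzeq] at tx ty
  set B := 2 * (1 - (1 - exp (2 * P z))) / (1 - exp (2 * P z)) ^ 3
  have hs : speed P z = 1 / (1 - exp (2 * P z)) := by rw [speed, one_div]
  rw [hs]
  set A := 1 / (1 - exp (2 * P z))
  have e1 : a * (A + B * (z - x)) + b * (A + B * (z - y)) = A := by
    have hb' : b = 1 - a := by linarith
    rw [hzdef, hb']
    ring
  rw [← e1]
  gcongr

lemma speed_sub_le (hP : IsNegBranch P) {x x' t : ℝ} (hx : 0 < x) (hxx : x ≤ x') (ht : 0 ≤ t) :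
    speed P x' - speed P (x' + t) ≤ speed P x - speed P (x + t) := by
  rcases ht.eq_or_lt with rfl | ht
  · simp
  have hc := hP.convexOn_speed
  set w := x' + t - x with hw
  have hw0 : 0 < w := by linarith
  have hb : 0 ≤ (x' - x) / w := div_nonneg (by linarith) hw0.le
  have ha : 0 ≤ t / w := by positivity
  have hab : t / w + (x' - x) / w = 1 := by
    rw [← add_div, div_eq_one_iff_eq hw0.ne']
    linarith
  have hmem : x' + t ∈ Ioi (0 : ℝ) := by
    rw [mem_Ioi]
    linarith
  have h1 := hc.2 hx hmem ha hb hab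
  have h2 := hc.2 hx hmem hb ha (by linarith)
  simp only [smul_eq_mul] at h1 h2
  have e1 : t / w * x + (x' - x) / w * (x' + t) = x' := by
    field_simp
    rw [hw]
    ring
  have e2 : (x' - x) / w * x + t / w * (x' + t) = x + t := by
    field_simp
    rw [hw]
    ring
  rw [e1] at h1
  rw [e2] at h2
  have : (t / w + (x' - x) / w) * (speed P x + speed P (x' + t)) = speed P x + speed P (x' + t) := by
    rw [hab, one_mul]
  linarith

/-- Along an affine line, `-P` is a primitive of `speed`. -/
lemma intervalIntegrable_speed (hP : IsNegBranch P) {x k a T : ℝ} (hx : 0 ≤ x) (hk : 0 < k)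
    (hT : 0 ≤ T) : IntervalIntegrable (fun t => speed P (x + k * (t - a))) volume a (a + T) ∧
      ∫ t in a..(a + T), speed P (x + k * (t - a)) = (P x - P (x + k * T)) / k := by
  have hcont : ContinuousOn (fun t => -P (x + k * (t - a)) / k) (Icc a (a + T)) := by
    have : ContinuousOn (fun t => P (x + k * (t - a))) (Icc a (a + T)) := by
      refine hP.continuousOn.comp (by fun_prop) fun t ht => mem_Ici.2 ?_
      have : 0 ≤ k * (t - a) := mul_nonneg hk.le (by linarith [ht.1])
      linarith
    exact this.neg.div_const k
  have hpos : ∀ t ∈ Ioo a (a + T), 0 < x + k * (t - a) := fun t ht => by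
    have : 0 < k * (t - a) := mul_pos hk (by linarith [ht.1])
    linarith
  have hder : ∀ t ∈ Ioo a (a + T), HasDerivAt (fun t => -P (x + k * (t - a)) / k)
      (speed P (x + k * (t - a))) t := fun t ht => by
    have h1 : HasDerivAt (fun t => x + k * (t - a)) (k * 1) t :=
      (((hasDerivAt_id t).sub_const a).const_mul k).const_add x
    have h2 := ((hP.hasDerivAt (hpos t ht)).comp t h1).neg.div_const k
    rw [show speed P (x + k * (t - a)) =
      -(-(1 - exp (2 * P (x + k * (t - a))))⁻¹ * (k * 1)) / k by
        rw [speed]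
        field_simp]
    exact h2
  have hInt : IntervalIntegrable (fun t => speed P (x + k * (t - a))) volume a (a + T) := by
    rw [intervalIntegrable_iff_integrableOn_Ioc_of_le (by linarith)]
    exact intervalIntegral.integrableOn_deriv_of_nonneg hcont hder
      fun t ht => (hP.speed_pos (hpos t ht)).le
  refine ⟨hInt, ?_⟩
  rw [intervalIntegral.integral_eq_sub_of_hasDerivAt_of_le (by linarith) hcont hder hInt]
  simp only [sub_self, mul_zero, add_zero, add_sub_cancel_left]
  ring

end IsNegBranch

/-- The logarithm of `sin ψ`, normalised to vanish at `π / 3`. -/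
noncomputable def logSin (ψ : ℝ) : ℝ := log (2 / √3 * sin ψ)

lemma logSin_pi_div_three : logSin (π / 3) = 0 := by
  rw [logSin, sin_pi_div_three, show (2 : ℝ) / √3 * (√3 / 2) = 1 by field_simp, log_one]

lemma logSin_pi_div_two : logSin (π / 2) = log (2 / √3) := by
  rw [logSin, sin_pi_div_two, mul_one]

lemma logSin_pi_sub (ψ : ℝ) : logSin (π - ψ) = logSin ψ := by
  rw [logSin, sin_pi_sub, logSin]

lemma continuousOn_logSin : ContinuousOn logSin (Ioo 0 π) := by
  unfold logSin
  refine ContinuousOn.log (by fun_prop) fun ψ hψ => ?_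
  have := sin_pos_of_mem_Ioo hψ
  positivity

lemma concaveOn_logSin : ConcaveOn ℝ (Ioo 0 π) logSin := by
  refine ⟨convex_Ioo 0 π, fun x hx y hy a b ha hb hab => ?_⟩
  have h1 := strictConcaveOn_sin_Icc.concaveOn.2 (Ioo_subset_Icc_self hx)
    (Ioo_subset_Icc_self hy) ha hb hab
  have hsx := sin_pos_of_mem_Ioo hx
  have hsy := sin_pos_of_mem_Ioo hy
  have hpx : 2 / √3 * sin x ∈ Ioi (0 : ℝ) := mem_Ioi.2 (by positivity)
  have hpy : 2 / √3 * sin y ∈ Ioi (0 : ℝ) := mem_Ioi.2 (by positivity)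
  have hpos := convex_Ioi (0 : ℝ) hpx hpy ha hb hab
  refine (strictConcaveOn_log_Ioi.concaveOn.2 hpx hpy ha hb hab).trans ?_
  refine log_le_log hpos ?_
  calc a • (2 / √3 * sin x) + b • (2 / √3 * sin y) = 2 / √3 * (a • sin x + b • sin y) := by
        simp only [smul_eq_mul]
        ring
    _ ≤ 2 / √3 * sin (a • x + b • y) := by gcongr

/-- A chord of the concave function `logSin` starting at `π / 3`. -/
lemma le_logSin_of_mem_Icc {k T ψ : ℝ} (hT : 0 < T) (hT2 : T ≤ π / 6)
    (hk : k * T ≤ logSin (π / 3 + T)) (hψ : ψ ∈ Icc (π / 3) (π / 3 + T)) :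
    k * (ψ - π / 3) ≤ logSin ψ := by
  have hπ := pi_pos
  have hx : π / 3 ∈ Ioo 0 π := ⟨by linarith, by linarith⟩
  have hy : π / 3 + T ∈ Ioo 0 π := ⟨by linarith, by linarith⟩
  have ha : 0 ≤ (π / 3 + T - ψ) / T := div_nonneg (by linarith [hψ.2]) hT.le
  have hb : 0 ≤ (ψ - π / 3) / T := div_nonneg (by linarith [hψ.1]) hT.le
  have h := concaveOn_logSin.2 hx hy ha hb (by field_simp; ring)
  simp only [smul_eq_mul, logSin_pi_div_three, mul_zero, zero_add] at h
  rw [show (π / 3 + T - ψ) / T * (π / 3) + (ψ - π / 3) / T * (π / 3 + T) = ψ by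
    field_simp; ring] at h
  refine le_trans ?_ h
  calc k * (ψ - π / 3) = (ψ - π / 3) / T * (k * T) := by field_simp
    _ ≤ _ := by gcongr

lemma logSin_monotoneOn : MonotoneOn logSin (Icc (π / 3) (π / 2)) := by
  intro x hx y hy hxy
  have hπ := pi_pos
  have hs : 0 < sin x := sin_pos_of_pos_of_lt_pi (by linarith [hx.1]) (by linarith [hx.2])
  unfold logSin
  have : sin x ≤ sin y := sin_le_sin_of_le_of_le_pi_div_two (by linarith [hx.1]) hy.2 hxy
  gcongr

lemma log_two_div_sqrt_three_pos : 0 < log (2 / √3) := by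
  refine log_pos ?_
  rw [one_lt_div (by positivity)]
  rw [sqrt_lt' (by norm_num)]
  norm_num

/-- The slope of the chord of `logSin` over `[π / 3, π / 2]`. -/
noncomputable def chordSlope : ℝ := log (2 / √3) / (π / 6)

lemma chordSlope_pos : 0 < chordSlope :=
  div_pos log_two_div_sqrt_three_pos (by positivity)

lemma chord_le_logSin {ψ : ℝ} (hψ : ψ ∈ Icc (π / 3) (π / 2)) :
    chordSlope * (ψ - π / 3) ≤ logSin ψ := by
  have e : π / 3 + π / 6 = π / 2 := by ring
  refine le_logSin_of_mem_Icc (T := π / 6) (by positivity) le_rfl ?_ (by rwa [e])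
  rw [e, logSin_pi_div_two, chordSlope]
  field_simp
  exact le_rfl

lemma logSin_pos {ψ : ℝ} (hψ : ψ ∈ Ioc (π / 3) (π / 2)) : 0 < logSin ψ :=
  (mul_pos chordSlope_pos (by linarith [hψ.1])).trans_le (chord_le_logSin (Ioc_subset_Icc_self hψ))

/-- Half of the change of angle along the arc on the negative branch. -/
noncomputable def halfAngle (P : ℝ → ℝ) (x : ℝ) : ℝ :=
  ∫ ψ in (π / 3)..(π / 2), speed P (x + logSin ψ)

namespace IsNegBranch

variable {P : ℝ → ℝ}

lemma speed_chord_integral (hP : IsNegBranch P) {x : ℝ} (hx : 0 ≤ x) :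
    IntervalIntegrable (fun ψ => speed P (x + chordSlope * (ψ - π / 3))) volume (π / 3) (π / 2) ∧
      ∫ ψ in (π / 3)..(π / 2), speed P (x + chordSlope * (ψ - π / 3)) =
        (P x - P (x + log (2 / √3))) / chordSlope := by
  have h := hP.intervalIntegrable_speed (a := π / 3) (T := π / 6) hx chordSlope_pos
    (by positivity)
  rwa [show π / 3 + π / 6 = π / 2 by ring,
    show chordSlope * (π / 6) = log (2 / √3) by rw [chordSlope]; field_simp] at h

lemma continuousOn_speed_logSin (hP : IsNegBranch P) {x : ℝ} (hx : 0 ≤ x) :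
    ContinuousOn (fun ψ => speed P (x + logSin ψ)) (Ioc (π / 3) (π / 2)) := by
  have hπ := pi_pos
  refine hP.continuousOn_speed.comp (continuousOn_const.add (continuousOn_logSin.mono ?_)) ?_
  · exact fun ψ hψ => ⟨by linarith [hψ.1], by linarith [hψ.2]⟩
  · intro ψ hψ
    have := logSin_pos hψ
    exact mem_Ioi.2 (by linarith)

lemma speed_logSin_le (hP : IsNegBranch P) {x ψ : ℝ} (hx : 0 ≤ x) (hψ : ψ ∈ Ioc (π / 3) (π / 2)) :
    speed P (x + logSin ψ) ≤ speed P (0 + chordSlope * (ψ - π / 3)) := by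
  have h1 := chord_le_logSin (Ioc_subset_Icc_self hψ)
  have h2 : 0 < chordSlope * (ψ - π / 3) := mul_pos chordSlope_pos (by linarith [hψ.1])
  exact hP.speed_anti (by linarith) (by linarith)

lemma norm_speed_logSin_le (hP : IsNegBranch P) {x ψ : ℝ} (hx : 0 ≤ x)
    (hψ : ψ ∈ Ioc (π / 3) (π / 2)) :
    ‖speed P (x + logSin ψ)‖ ≤ speed P (0 + chordSlope * (ψ - π / 3)) := by
  have h3 := logSin_pos hψ
  rw [norm_of_nonneg (hP.speed_nonneg (by linarith))]
  exact hP.speed_logSin_le hx hψ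

lemma intervalIntegrable_speed_logSin (hP : IsNegBranch P) {x : ℝ} (hx : 0 ≤ x) :
    IntervalIntegrable (fun ψ => speed P (x + logSin ψ)) volume (π / 3) (π / 2) := by
  have hπ : π / 3 ≤ π / 2 := by linarith [pi_pos]
  have hb := (hP.speed_chord_integral le_rfl).1
  rw [intervalIntegrable_iff_integrableOn_Ioc_of_le hπ] at hb ⊢
  refine hb.mono' ((hP.continuousOn_speed_logSin hx).aestronglyMeasurable measurableSet_Ioc) ?_
  filter_upwards [ae_restrict_mem measurableSet_Ioc] with ψ hψ using hP.norm_speed_logSin_le hx hψ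

lemma continuousOn_halfAngle (hP : IsNegBranch P) : ContinuousOn (halfAngle P) (Ici 0) := by
  have hπ : π / 3 ≤ π / 2 := by linarith [pi_pos]
  intro x hx
  refine intervalIntegral.continuousWithinAt_of_dominated_interval
    (bound := fun ψ => speed P (0 + chordSlope * (ψ - π / 3))) ?_ ?_
    (hP.speed_chord_integral le_rfl).1 ?_
  · filter_upwards [self_mem_nhdsWithin] with y hy
    rw [uIoc_of_le hπ]
    exact (hP.continuousOn_speed_logSin hy).aestronglyMeasurable measurableSet_Ioc
  · filter_upwards [self_mem_nhdsWithin] with y hy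
    refine ae_of_all _ fun ψ hψ => ?_
    rw [uIoc_of_le hπ] at hψ
    exact hP.norm_speed_logSin_le hy hψ
  · refine ae_of_all _ fun ψ hψ => ContinuousAt.continuousWithinAt ?_
    rw [uIoc_of_le hπ] at hψ
    have h3 := logSin_pos hψ
    have h4 : 0 < x + logSin ψ := by linarith [mem_Ici.1 hx]
    exact ContinuousAt.comp (f := fun x => x + logSin ψ)
      (hP.continuousOn_speed.continuousAt (Ioi_mem_nhds h4)) (by fun_prop)

lemma halfAngle_sub_le (hP : IsNegBranch P) {x y : ℝ} (hx : 0 ≤ x) (hxy : x ≤ y) :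
    halfAngle P x - halfAngle P y ≤ (P x - P y) / chordSlope := by
  have hπ : π / 3 ≤ π / 2 := by linarith [pi_pos]
  have hy := hx.trans hxy
  obtain ⟨ix, ex⟩ := hP.speed_chord_integral hx
  obtain ⟨iy, ey⟩ := hP.speed_chord_integral hy
  have hl := log_two_div_sqrt_three_pos
  unfold halfAngle
  rw [← intervalIntegral.integral_sub (hP.intervalIntegrable_speed_logSin hx)
    (hP.intervalIntegrable_speed_logSin hy)]
  calc ∫ ψ in (π / 3)..(π / 2), (speed P (x + logSin ψ) - speed P (y + logSin ψ))
      ≤ ∫ ψ in (π / 3)..(π / 2), (speed P (x + chordSlope * (ψ - π / 3)) -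
          speed P (y + chordSlope * (ψ - π / 3))) := by
        refine intervalIntegral.integral_mono_on_of_le_Ioo hπ
          ((hP.intervalIntegrable_speed_logSin hx).sub (hP.intervalIntegrable_speed_logSin hy))
          (ix.sub iy) fun ψ hψ => ?_
        have h1 := chord_le_logSin (Ioo_subset_Icc_self hψ)
        have h2 : 0 < chordSlope * (ψ - π / 3) := mul_pos chordSlope_pos (by linarith [hψ.1])
        have h := hP.speed_sub_le (x := x + chordSlope * (ψ - π / 3)) (x' := x + logSin ψ)
          (t := y - x) (by linarith) (by linarith) (by linarith)
        convert h using 3 <;> ring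
    _ = (P x - P y) / chordSlope -
          (P (x + log (2 / √3)) - P (y + log (2 / √3))) / chordSlope := by
        rw [intervalIntegral.integral_sub ix iy, ex, ey]
        ring
    _ ≤ (P x - P y) / chordSlope := by
        have h1 : P (y + log (2 / √3)) ≤ P (x + log (2 / √3)) :=
          hP.strictAntiOn.antitoneOn (mem_Ici.2 (by linarith)) (mem_Ici.2 (by linarith))
            (by linarith)
        have h2 := div_nonneg (sub_nonneg.2 h1) chordSlope_pos.le
        linarith

end IsNegBranch

/-- The density of the angle in the coordinate `s = log R`, as a function of `v`, where
`K = (√3 / 2) c exp (-v)`. It is truncated so as to be continuous on the whole line. -/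
noncomputable def angleDensity (v : ℝ) : ℝ := (√(max (4 / 3 * exp (2 * v) - 1) (1 / 3)))⁻¹

lemma continuous_angleDensity : Continuous angleDensity := by
  unfold angleDensity
  refine Continuous.inv₀ (by fun_prop) fun v => ?_
  have : (0 : ℝ) < max (4 / 3 * exp (2 * v) - 1) (1 / 3) := lt_max_of_lt_right (by norm_num)
  positivity

lemma angleDensity_of_nonneg {v : ℝ} (hv : 0 ≤ v) :
    angleDensity v = (√(4 / 3 * exp (2 * v) - 1))⁻¹ := by
  have : 1 ≤ exp (2 * v) := one_le_exp (by linarith)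
  rw [angleDensity, max_eq_left (by linarith)]

lemma le_angleDensity {v : ℝ} (h : 4 / 3 * exp (2 * v) ≤ 1.36) : 5 / 3 ≤ angleDensity v := by
  have hpos : (0 : ℝ) < max (4 / 3 * exp (2 * v) - 1) (1 / 3) := lt_max_of_lt_right (by norm_num)
  rw [angleDensity, le_inv_comm₀ (by norm_num) (sqrt_pos.2 hpos), sqrt_le_left (by norm_num)]
  exact max_le (by linarith) (by norm_num)

lemma angleDensity_sub_le {v w : ℝ} (hv : 0 ≤ v) (hvw : v ≤ w) (h : 4 / 3 * exp (2 * w) ≤ 1.36) :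
    angleDensity v - angleDensity w ≤ 7.1 * (w - v) := by
  rw [angleDensity_of_nonneg hv, angleDensity_of_nonneg (hv.trans hvw)]
  have hexp : exp (2 * w) - exp (2 * v) ≤ exp (2 * w) * (2 * (w - v)) := by
    have h1 := add_one_le_exp (-(2 * (w - v)))
    have h2 : exp (2 * v) = exp (2 * w) * exp (-(2 * (w - v))) := by
      rw [← exp_add]
      congr 1
      ring
    nlinarith [exp_pos (2 * w)]
  have hv1 : 1 ≤ exp (2 * v) := one_le_exp (by linarith)
  have hw1 : 1 ≤ exp (2 * w) := one_le_exp (by linarith)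
  set A := √(4 / 3 * exp (2 * v) - 1) with hA
  set B := √(4 / 3 * exp (2 * w) - 1) with hB
  have hA0 : 0.577 ≤ A := le_sqrt_of_sq_le (by norm_num; linarith)
  have hB0 : 0.577 ≤ B := le_sqrt_of_sq_le (by norm_num; linarith)
  have hA3 : 1 / √3 ≤ A := by
    rw [hA, ← sqrt_one, ← sqrt_div zero_le_one, sqrt_one]
    exact sqrt_le_sqrt (by linarith)
  have hB3 : 1 / √3 ≤ B := by
    rw [hB, ← sqrt_one, ← sqrt_div zero_le_one, sqrt_one]
    exact sqrt_le_sqrt (by linarith)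
  have hAB : 1 / 3 ≤ A * B := by
    calc (1 : ℝ) / 3 = 1 / √3 * (1 / √3) := by
          rw [div_mul_div_comm, one_mul, mul_self_sqrt (by norm_num)]
      _ ≤ A * B := by gcongr
  have hA2 : A ^ 2 = 4 / 3 * exp (2 * v) - 1 := sq_sqrt (by linarith)
  have hB2 : B ^ 2 = 4 / 3 * exp (2 * w) - 1 := sq_sqrt (by linarith)
  have hd : 0 ≤ w - v := by linarith
  have hBA : B - A ≤ 2.36 * (w - v) := by
    have h1 : (B - A) * (A + B) ≤ 2.72 * (w - v) := by nlinarith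
    have h2 : 1.154 ≤ A + B := by linarith
    by_contra! hcon
    nlinarith
  have e : A⁻¹ - B⁻¹ = (B - A) / (A * B) := by field_simp
  rw [e, div_le_iff₀ (by positivity)]
  nlinarith

/-- The change of angle between the branches `P` and `N`. -/
noncomputable def arcAngle (P N : ℝ → ℝ) (x : ℝ) : ℝ :=
  ∫ s in (P x)..(N x), angleDensity (x - logK s)

section Branches

variable {P N : ℝ → ℝ}

lemma logK_le_of_mem_Icc (hP : IsNegBranch P) (hN : IsPosBranch N) {x s : ℝ} (hx : 0 ≤ x)
    (hs : s ∈ Icc (P x) (N x)) : logK s ≤ x := by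
  rcases le_total s 0 with h | h
  · exact (hP.le_iff hx h).1 hs.1
  · exact (hN.le_iff hx h).1 hs.2

lemma continuous_angleDensity_sub (x : ℝ) : Continuous fun s => angleDensity (x - logK s) :=
  continuous_angleDensity.comp (continuous_const.sub continuous_logK)

lemma continuousOn_arcAngle (hP : IsNegBranch P) (hN : IsPosBranch N) :
    ContinuousOn (arcAngle P N) (Ici 0) := by
  have hu : Continuous (Function.uncurry fun (x : Ici (0 : ℝ)) s => angleDensity (x - logK s)) :=
    continuous_angleDensity.comp ((continuous_subtype_val.comp continuous_fst).sub
      (continuous_logK.comp continuous_snd))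
  have h1 := intervalIntegral.continuous_parametric_intervalIntegral_of_continuous (a₀ := 0)
    (μ := volume) hu (continuousOn_iff_continuous_domRestrict.1 hN.continuousOn)
  have h2 := intervalIntegral.continuous_parametric_intervalIntegral_of_continuous (a₀ := 0)
    (μ := volume) hu (continuousOn_iff_continuous_domRestrict.1 hP.continuousOn)
  rw [continuousOn_iff_continuous_domRestrict]
  refine (h1.sub h2).congr fun x => ?_
  exact intervalIntegral.integral_interval_sub_left
    ((continuous_angleDensity_sub x).intervalIntegrable _ _)
    ((continuous_angleDensity_sub x).intervalIntegrable _ _)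

lemma le_arcAngle (hP : IsNegBranch P) (hN : IsPosBranch N) {x : ℝ} (hx : 0 ≤ x)
    (h : 4 / 3 * exp (2 * x) ≤ 1.36) : 5 / 3 * (N x - P x) ≤ arcAngle P N x := by
  have hPN : P x ≤ N x := (hP x hx).1.trans (hN x hx).1
  have := intervalIntegral.integral_mono_on (μ := volume) (f := fun _ => (5 / 3 : ℝ)) hPN
    intervalIntegrable_const ((continuous_angleDensity_sub x).intervalIntegrable _ _)
    fun s _ => le_angleDensity (v := x - logK s) (by
      have : exp (2 * (x - logK s)) ≤ exp (2 * x) := by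
        gcongr
        linarith [logK_nonneg s]
      linarith)
  rw [intervalIntegral.integral_const, smul_eq_mul] at this
  unfold arcAngle
  linarith

lemma le_arcAngle_sub (hP : IsNegBranch P) (hN : IsPosBranch N) {x y : ℝ} (hx : 0 ≤ x)
    (hxy : x ≤ y) (h : 4 / 3 * exp (2 * y) ≤ 1.36) :
    5 / 3 * ((N y - N x) + (P x - P y)) - 7.1 * (y - x) * (N x - P x) ≤
      arcAngle P N y - arcAngle P N x := by
  have hy := hx.trans hxy
  have hPx : P x ≤ N x := (hP x hx).1.trans (hN x hx).1
  have hPP : P y ≤ P x := hP.strictAntiOn.antitoneOn hx hy hxy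
  have hNN : N x ≤ N y := hN.strictMonoOn.monotoneOn hx hy hxy
  have hle : ∀ s, 4 / 3 * exp (2 * (y - logK s)) ≤ 1.36 := fun s => by
    have : exp (2 * (y - logK s)) ≤ exp (2 * y) := by
      gcongr
      linarith [logK_nonneg s]
    linarith
  have int : ∀ z a b, IntervalIntegrable (fun s => angleDensity (z - logK s)) volume a b :=
    fun z a b => (continuous_angleDensity_sub z).intervalIntegrable _ _
  have shell : ∀ a b, a ≤ b → 5 / 3 * (b - a) ≤ ∫ s in a..b, angleDensity (y - logK s) :=
    fun a b hab => by
      have := intervalIntegral.integral_mono_on (μ := volume) (f := fun _ => (5 / 3 : ℝ)) hab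
        intervalIntegrable_const (int y a b) fun s _ => le_angleDensity (hle s)
      rw [intervalIntegral.integral_const, smul_eq_mul] at this
      linarith
  have inner : (∫ s in (P x)..(N x), angleDensity (x - logK s)) -
      ∫ s in (P x)..(N x), angleDensity (y - logK s) ≤ 7.1 * (y - x) * (N x - P x) := by
    rw [← intervalIntegral.integral_sub (int _ _ _) (int _ _ _)]
    have := intervalIntegral.integral_mono_on (μ := volume) hPx
      ((int x _ _).sub (int y _ _)) (intervalIntegrable_const (c := 7.1 * (y - x)))
      fun s hs => by
        have := angleDensity_sub_le (v := x - logK s) (w := y - logK s)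
          (by linarith [logK_le_of_mem_Icc hP hN hx hs]) (by linarith) (hle s)
        rwa [sub_sub_sub_cancel_right] at this
    rw [intervalIntegral.integral_const, smul_eq_mul] at this
    linarith
  have split : arcAngle P N y = (∫ s in (P y)..(P x), angleDensity (y - logK s)) +
      (∫ s in (P x)..(N x), angleDensity (y - logK s)) +
        ∫ s in (N x)..(N y), angleDensity (y - logK s) := by
    rw [intervalIntegral.integral_add_adjacent_intervals (int _ _ _) (int _ _ _),
      intervalIntegral.integral_add_adjacent_intervals (int _ _ _) (int _ _ _), arcAngle]
  have s1 := shell _ _ hPP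
  have s2 := shell _ _ hNN
  rw [split]
  unfold arcAngle
  linarith

/-- The positive branch is at least `4 / 5` times as steep as the negative one, as long as
`R² ≤ 5 / 4`. -/
lemma branch_slope_le (hP : IsNegBranch P) (hN : IsPosBranch N) {x y : ℝ} (hx : 0 ≤ x)
    (hxy : x ≤ y) (h : exp (2 * N y) ≤ 1.25) : 0.8 * (P x - P y) ≤ N y - N x := by
  have key : ∀ z ∈ Ioo 0 y, 0.8 * (1 - exp (2 * P z))⁻¹ ≤ (exp (2 * N z) - 1)⁻¹ := by
    intro z hz
    have hPz := hP.exp_lt_one hz.1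
    have hNz : 1 < exp (2 * N z) := by
      rw [one_lt_exp_iff]
      linarith [hN.pos hz.1]
    have hNy : exp (2 * N z) ≤ 1.25 := by
      refine le_trans ?_ h
      gcongr
      exact hN.strictMonoOn.monotoneOn hz.1.le (hz.1.trans hz.2).le hz.2.le
    set b := exp (2 * N z) - 1 with hb
    have hb0 : 0 < b := by linarith
    have hb1 : b ≤ 0.25 := by linarith
    suffices hkey : 0.8 * b ≤ 1 - exp (2 * P z) by
      have h1 : 0 < 1 - exp (2 * P z) := by linarith
      rw [← div_eq_mul_inv, div_le_iff₀ h1, inv_mul_eq_div, le_div_iff₀ hb0]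
      exact hkey
    have mono : MonotoneOn (fun t => (t - log (1 + t)) - (-(0.8 * t) - log (1 - 0.8 * t)))
        (Icc 0 0.25) := by
      have hd : ∀ t ∈ Icc (0 : ℝ) 0.25, HasDerivAt
          (fun t => (t - log (1 + t)) - (-(0.8 * t) - log (1 - 0.8 * t)))
          ((1 - 1 / (1 + t)) - (-(0.8 * 1) - (-(0.8 * 1)) / (1 - 0.8 * t))) t := fun t ht => by
        have h1 : (1 : ℝ) + t ≠ 0 := by linarith [ht.1]
        have h2 : (1 : ℝ) - 0.8 * t ≠ 0 := by linarith [ht.2]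
        exact ((hasDerivAt_id t).sub (((hasDerivAt_id t).const_add 1).log h1)).sub
          (((hasDerivAt_id t).const_mul 0.8).neg.sub
            ((((hasDerivAt_id t).const_mul 0.8).const_sub 1).log h2))
      refine monotoneOn_of_deriv_nonneg (convex_Icc _ _)
        (fun t ht => (hd t ht).continuousAt.continuousWithinAt)
        (fun t ht => (hd t (interior_subset ht)).differentiableAt.differentiableWithinAt)
        fun t ht => ?_
      have ht := interior_subset ht
      rw [(hd t ht).deriv]
      have h1 : 0 < 1 + t := by linarith [ht.1]
      have h2 : 0 < 1 - 0.8 * t := by linarith [ht.2]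
      have e : (1 - 1 / (1 + t)) - (-(0.8 * 1) - (-(0.8 * 1)) / (1 - 0.8 * t)) =
          t * (0.36 - 1.44 * t) / ((1 + t) * (1 - 0.8 * t)) := by
        rw [eq_div_iff (by positivity)]
        linear_combination -(1 - 0.8 * t) * one_div_mul_cancel h1.ne' +
          (1 + t) * div_mul_cancel₀ (-(0.8 * 1) : ℝ) h2.ne'
      rw [e]
      have := ht.1
      have : 0 ≤ 0.36 - 1.44 * t := by linarith [ht.2]
      positivity
    have hm := mono (left_mem_Icc.2 (by norm_num)) ⟨hb0.le, hb1⟩ hb0.le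
    simp only [mul_zero, add_zero, sub_zero, log_one, neg_zero] at hm
    have e1 : log (1 + b) = 2 * N z := by rw [hb, add_sub_cancel, log_exp]
    rw [e1] at hm
    have hNz2 := (hN z hz.1.le).2
    have hb2 : (0 : ℝ) < 1 - 0.8 * b := by linarith
    have hlog : logK (log (1 - 0.8 * b) / 2) ≤ z := by
      rw [logK, mul_div_cancel₀ _ two_ne_zero, exp_log hb2]
      unfold logK at hNz2
      linarith
    have := (hP.le_iff hz.1.le (by
      have := log_nonpos hb2.le (by linarith)
      linarith)).2 hlog
    have : exp (2 * P z) ≤ 1 - 0.8 * b := by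
      rw [← le_log_iff_exp_le hb2]
      linarith
    linarith
  have hmono : MonotoneOn (fun z => N z + 0.8 * P z) (Icc 0 y) := by
    have hd : ∀ z ∈ Ioo 0 y, HasDerivAt (fun z => N z + 0.8 * P z)
        ((exp (2 * N z) - 1)⁻¹ + 0.8 * -(1 - exp (2 * P z))⁻¹) z :=
      fun z hz => (hN.hasDerivAt hz.1).add ((hP.hasDerivAt hz.1).const_mul 0.8)
    refine monotoneOn_of_deriv_nonneg (convex_Icc _ _) ?_ ?_ ?_
    · exact (hN.continuousOn.add (hP.continuousOn.const_mul _)).mono Icc_subset_Ici_self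
    · rw [interior_Icc]
      exact fun z hz => (hd z hz).differentiableAt.differentiableWithinAt
    · rw [interior_Icc]
      intro z hz
      rw [(hd z hz).deriv]
      linarith [key z hz]
  have := hmono ⟨hx, hxy⟩ ⟨hx.trans hxy, le_rfl⟩ hxy
  dsimp only at this
  linarith

lemma sub_le_branch_sub (hP : IsNegBranch P) {x y : ℝ} (hx : 0 ≤ x)
    (hxy : x ≤ y) (h : 0.81 ≤ exp (2 * P y)) : y - x ≤ 0.19 * (P x - P y) := by
  have hPP : P y ≤ P x := hP.strictAntiOn.antitoneOn hx (hx.trans hxy) hxy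
  have hmono : MonotoneOn (fun s => logK s + 0.19 * s) (Ici (P y)) := by
    have hd : ∀ s, HasDerivAt (fun s => logK s + 0.19 * s) ((exp (2 * s) - 1) + 0.19 * 1) s :=
      fun s => (hasDerivAt_logK s).add ((hasDerivAt_id s).const_mul 0.19)
    refine monotoneOn_of_deriv_nonneg (convex_Ici _)
      (fun s _ => (hd s).continuousAt.continuousWithinAt)
      (fun s _ => (hd s).differentiableAt.differentiableWithinAt) fun s hs => ?_
    rw [interior_Ici] at hs
    rw [(hd s).deriv]
    have : exp (2 * P y) ≤ exp (2 * s) := by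
      gcongr
      exact (mem_Ioi.1 hs).le
    linarith
  have := hmono (mem_Ici.2 le_rfl) (mem_Ici.2 hPP) hPP
  dsimp only at this
  rw [(hP x hx).2, (hP y (hx.trans hxy)).2] at this
  linarith

end Branches

lemma exp_le_taylor {x : ℝ} (h0 : 0 ≤ x) (h1 : x ≤ 1) :
    exp x ≤ 1 + x + x ^ 2 / 2 + x ^ 3 / 6 + x ^ 4 / 24 + x ^ 5 / 120 + x ^ 6 / 720 +
      x ^ 7 * 8 / 35280 := by
  have h := exp_bound' h0 h1 (n := 7) (by norm_num)
  norm_num [Finset.sum_range_succ, Nat.factorial] at h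
  linarith

lemma taylor_le_exp {x : ℝ} (h0 : 0 ≤ x) :
    1 + x + x ^ 2 / 2 + x ^ 3 / 6 + x ^ 4 / 24 + x ^ 5 / 120 + x ^ 6 / 720 ≤ exp x := by
  have h := sum_le_exp_of_nonneg h0 7
  norm_num [Finset.sum_range_succ, Nat.factorial] at h
  linarith

lemma exp_neg_le_of_mul_taylor {x r : ℝ} (h0 : 0 ≤ x) (h : 1 ≤ r * (1 + x + x ^ 2 / 2 + x ^ 3 / 6 +
    x ^ 4 / 24 + x ^ 5 / 120 + x ^ 6 / 720)) : exp (-x) ≤ r := by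
  rw [exp_neg, inv_le_iff_one_le_mul₀ (exp_pos x)]
  have hr : 0 ≤ r := by
    by_contra! hr
    have : 0 < 1 + x + x ^ 2 / 2 + x ^ 3 / 6 + x ^ 4 / 24 + x ^ 5 / 120 + x ^ 6 / 720 := by
      positivity
    nlinarith
  exact h.trans (mul_le_mul_of_nonneg_left (taylor_le_exp h0) hr)

lemma le_exp_neg_of_mul_taylor {x r : ℝ} (h0 : 0 ≤ x) (h1 : x ≤ 1) (hr : 0 ≤ r)
    (h : r * (1 + x + x ^ 2 / 2 + x ^ 3 / 6 + x ^ 4 / 24 + x ^ 5 / 120 + x ^ 6 / 720 +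
      x ^ 7 * 8 / 35280) ≤ 1) : r ≤ exp (-x) := by
  rw [exp_neg, ← one_div, le_div_iff₀ (exp_pos x)]
  exact (mul_le_mul_of_nonneg_left (exp_le_taylor h0 h1) hr).trans h

lemma log_two_div_sqrt_three : log (2 / √3) = log (4 / 3) / 2 := by
  have h : (4 / 3 : ℝ) = (2 / √3) ^ 2 := by
    rw [div_pow, sq_sqrt (by norm_num)]
    norm_num
  rw [h, log_pow]
  push_cast
  ring

lemma lt_log_two_div_sqrt_three : 0.1438 < log (2 / √3) := by
  have h : 0.28765 ≤ log (4 / 3) := by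
    rw [le_log_iff_exp_le (by norm_num)]
    exact (exp_le_taylor (by norm_num) (by norm_num)).trans (by norm_num)
  rw [log_two_div_sqrt_three]
  linarith

lemma log_two_div_sqrt_three_lt : log (2 / √3) < 0.143845 := by
  have h : log (4 / 3) ≤ 0.287689 := by
    rw [log_le_iff_le_exp (by norm_num)]
    exact le_trans (by norm_num) (taylor_le_exp (by norm_num))
  rw [log_two_div_sqrt_three]
  linarith

lemma lt_chordSlope : 0.274 < chordSlope := by
  rw [chordSlope, lt_div_iff₀ (by positivity)]
  linarith [lt_log_two_div_sqrt_three, pi_lt_d6]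

/-- The largest admissible value of `log (√3 / 2 * c)`. -/
noncomputable def maxLog : ℝ := 0.15325 - log (2 / √3)

lemma lt_maxLog : 0.009405 < maxLog := by
  unfold maxLog
  linarith [log_two_div_sqrt_three_lt]

lemma maxLog_lt : maxLog < 0.00945 := by
  unfold maxLog
  linarith [lt_log_two_div_sqrt_three]

lemma maxLog_pos : 0 < maxLog := lt_trans (by norm_num) lt_maxLog

lemma exp_two_maxLog_le : 4 / 3 * exp (2 * maxLog) ≤ 1.36 := by
  have h : exp (2 * maxLog) = exp 0.3065 * (4 / 3)⁻¹ := by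
    have e : 2 * maxLog = 0.3065 + -log (4 / 3) := by
      rw [maxLog, log_two_div_sqrt_three]
      ring
    rw [e, exp_add, exp_neg, exp_log (by norm_num)]
  have h2 : exp 0.3065 ≤ 1.36 :=
    (exp_le_taylor (by norm_num) (by norm_num)).trans (by norm_num)
  rw [h]
  linarith

section Branches

variable {P N : ℝ → ℝ}

lemma IsPosBranch.apply_maxLog_lt (hN : IsPosBranch N) : N maxLog < 0.1 := by
  rw [hN.lt_iff maxLog_pos.le (by norm_num)]
  refine maxLog_lt.trans ?_
  have := taylor_le_exp (x := 2 * 0.1) (by norm_num)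
  rw [logK]
  norm_num at this ⊢
  linarith

lemma IsPosBranch.le_apply_maxLog (hN : IsPosBranch N) : 0.093 ≤ N maxLog := by
  rw [hN.le_iff maxLog_pos.le (by norm_num)]
  refine le_trans ?_ lt_maxLog.le
  have := exp_le_taylor (x := 2 * 0.093) (by norm_num) (by norm_num)
  rw [logK]
  norm_num at this ⊢
  linarith

lemma IsNegBranch.lt_apply_maxLog (hP : IsNegBranch P) : -0.105 < P maxLog := by
  rw [hP.lt_iff maxLog_pos.le (by norm_num)]
  refine maxLog_lt.trans ?_
  have := le_exp_neg_of_mul_taylor (x := 0.21) (r := 0.81) (by norm_num) (by norm_num)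
    (by norm_num) (by norm_num)
  rw [logK]
  norm_num at this ⊢
  linarith

lemma IsNegBranch.apply_maxLog_le (hP : IsNegBranch P) : P maxLog ≤ -0.1 := by
  rw [hP.le_iff maxLog_pos.le (by norm_num)]
  refine le_trans ?_ lt_maxLog.le
  have := exp_neg_le_of_mul_taylor (x := 0.2) (r := 0.81874) (by norm_num) (by norm_num)
  rw [logK]
  norm_num at this ⊢
  linarith

/-- The total change of angle, as a function of `log (√3 / 2 * c)`. -/
noncomputable def totalAngle (P N : ℝ → ℝ) (x : ℝ) : ℝ := 2 * halfAngle P x + 3 * arcAngle P N x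

lemma continuousOn_totalAngle (hP : IsNegBranch P) (hN : IsPosBranch N) :
    ContinuousOn (totalAngle P N) (Ici 0) :=
  (hP.continuousOn_halfAngle.const_mul 2 : ContinuousOn (fun x => 2 * halfAngle P x) _).add
    ((continuousOn_arcAngle hP hN).const_mul 3)

lemma strictMonoOn_totalAngle (hP : IsNegBranch P) (hN : IsPosBranch N) :
    StrictMonoOn (totalAngle P N) (Icc 0 maxLog) := by
  intro x hx y hy hxy
  have hy0 : 0 ≤ y := hy.1
  have hNy : N y ≤ 0.1 :=
    (hN.strictMonoOn.monotoneOn hy0 maxLog_pos.le hy.2).trans hN.apply_maxLog_lt.le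
  have hPy : -0.105 ≤ P y :=
    hP.lt_apply_maxLog.le.trans (hP.strictAntiOn.antitoneOn hy0 maxLog_pos.le hy.2)
  have hNxy : N x < N y := hN.strictMonoOn hx.1 hy0 hxy
  have hPxy : P y < P x := hP.strictAntiOn hx.1 hy0 hxy
  have hexpN : exp (2 * N y) ≤ 1.25 := by
    have h1 : exp (2 * N y) ≤ exp 0.2 := exp_le_exp.2 (by linarith)
    exact h1.trans ((exp_le_taylor (by norm_num) (by norm_num)).trans (by norm_num))
  have hexpP : 0.81 ≤ exp (2 * P y) :=
    (le_exp_neg_of_mul_taylor (x := 0.21) (by norm_num) (by norm_num) (by norm_num)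
      (by norm_num)).trans (exp_le_exp.2 (by linarith))
  have hexp : 4 / 3 * exp (2 * y) ≤ 1.36 := by
    have : exp (2 * y) ≤ exp (2 * maxLog) := exp_le_exp.2 (by linarith [hy.2])
    linarith [exp_two_maxLog_le]
  have h1 := hP.halfAngle_sub_le hx.1 hxy.le
  have h2 := le_arcAngle_sub hP hN hx.1 hxy.le hexp
  have h3 := branch_slope_le hP hN hx.1 hxy.le hexpN
  have h4 := sub_le_branch_sub hP hx.1 hxy.le hexpP
  have h5 : (P x - P y) / chordSlope ≤ 3.66 * (P x - P y) := by
    rw [div_le_iff₀ chordSlope_pos]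
    nlinarith [lt_chordSlope]
  have h6 : (y - x) * (N x - P x) ≤ 0.19 * (P x - P y) * 0.205 :=
    mul_le_mul h4 (by linarith) (by linarith [(hP x hx.1).1, (hN x hx.1).1])
      (by linarith)
  unfold totalAngle
  linarith

lemma halfAngle_zero_lt (hP : IsNegBranch P) : halfAngle P 0 < π / 2 := by
  have hπ := pi_gt_d6
  have hπ' := pi_lt_d6
  set T := π / 6 - 1 / 4 with hT
  have hT1 : 0.27359 < T := by linarith
  have hT2 : T < 0.2736 := by linarith
  have e : π / 3 + T = π / 2 - 1 / 4 := by rw [hT]; ring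
  have hsin : 0.11 ≤ logSin (π / 3 + T) := by
    rw [e, logSin, sin_pi_div_two_sub, le_log_iff_exp_le
      (mul_pos (by positivity) (cos_pos_of_mem_Ioo ⟨by linarith, by linarith⟩))]
    have h1 : exp 0.11 ≤ 1.1163 := (exp_le_taylor (by norm_num) (by norm_num)).trans (by norm_num)
    have h2 : (1.154 : ℝ) ≤ 2 / √3 := by
      rw [le_div_iff₀ (by positivity), ← le_div_iff₀' (by norm_num), sqrt_le_left (by norm_num)]
      norm_num
    have h3 := one_sub_sq_div_two_le_cos (x := 1 / 4)
    calc exp 0.11 ≤ 1.154 * (1 - (1 / 4) ^ 2 / 2) := h1.trans (by norm_num)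
      _ ≤ 2 / √3 * cos (1 / 4) := by gcongr
  have hInt := hP.intervalIntegrable_speed_logSin (x := 0) le_rfl
  have hsub1 : uIcc (π / 3) (π / 3 + T) ⊆ uIcc (π / 3) (π / 2) := by
    rw [uIcc_of_le (by linarith), uIcc_of_le (by linarith)]
    exact Icc_subset_Icc_right (by linarith)
  have hsub2 : uIcc (π / 3 + T) (π / 2) ⊆ uIcc (π / 3) (π / 2) := by
    rw [uIcc_of_le (by linarith), uIcc_of_le (by linarith)]
    exact Icc_subset_Icc_left (by linarith)
  have hInt1 := hInt.mono_set hsub1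
  have hInt2 := hInt.mono_set hsub2
  have b1 : ∫ ψ in (π / 3)..(π / 3 + T), speed P (0 + logSin ψ) ≤ 0.95 := by
    obtain ⟨i1, e1⟩ := hP.intervalIntegrable_speed (x := 0) (k := 0.4) (a := π / 3) (T := T) le_rfl
      (by norm_num) (by linarith)
    have h := intervalIntegral.integral_mono_on_of_le_Ioo (by linarith) hInt1 i1 fun ψ hψ => by
      have h1 := le_logSin_of_mem_Icc (k := 0.4) (T := T) (by linarith) (by linarith)
        (by linarith) (Ioo_subset_Icc_self hψ)
      exact hP.speed_anti (by linarith [hψ.1]) (by linarith)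
    refine h.trans ?_
    rw [e1, hP.apply_zero, zero_add, div_le_iff₀ (by norm_num)]
    have : -0.38 < P (0.4 * T) := by
      rw [hP.lt_iff (by linarith) (by norm_num)]
      have := le_exp_neg_of_mul_taylor (x := 0.76) (r := 0.467) (by norm_num) (by norm_num)
        (by norm_num) (by norm_num)
      rw [logK]
      norm_num at this ⊢
      linarith
    linarith
  have b2 : ∫ ψ in (π / 3 + T)..(π / 2), speed P (0 + logSin ψ) ≤ 0.5 := by
    have h := intervalIntegral.integral_mono_on (by linarith) hInt2
      (intervalIntegrable_const (c := (2 : ℝ))) fun ψ hψ => by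
        have h1 : 0.11 ≤ logSin ψ := hsin.trans
          (logSin_monotoneOn ⟨by linarith, by linarith⟩ ⟨by linarith [hψ.1], hψ.2⟩ hψ.1)
        have h2 : P 0.11 ≤ -0.35 := by
          rw [hP.le_iff (by norm_num) (by norm_num)]
          have := exp_neg_le_of_mul_taylor (x := 0.7) (r := 0.4967) (by norm_num) (by norm_num)
          rw [logK]
          norm_num at this ⊢
          linarith
        have h3 : speed P 0.11 ≤ 2 := by
          have h4 : exp (2 * P 0.11) ≤ 0.5 := le_trans (exp_le_exp.2 (by linarith))
            (exp_neg_le_of_mul_taylor (x := 0.7) (by norm_num) (by norm_num))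
          rw [speed]
          exact inv_le_of_inv_le₀ (by norm_num) (by linarith)
        exact (hP.speed_anti (by norm_num) (by linarith)).trans h3
    rw [intervalIntegral.integral_const, smul_eq_mul] at h
    linarith
  rw [halfAngle, ← intervalIntegral.integral_add_adjacent_intervals hInt1 hInt2]
  linarith

lemma totalAngle_zero_lt (hP : IsNegBranch P) (hN : IsPosBranch N) : totalAngle P N 0 < π := by
  have h : arcAngle P N 0 = 0 := by
    rw [arcAngle, hP.apply_zero, hN.apply_zero, intervalIntegral.integral_same]
  rw [totalAngle, h]
  linarith [halfAngle_zero_lt hP]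

end Branches

lemma add_cube_div_three_le_tan {x : ℝ} (h0 : 0 ≤ x) (h1 : x < π / 2) :
    x + x ^ 3 / 3 ≤ tan x := by
  have hcos : ∀ t ∈ Icc 0 x, 0 < cos t := fun t ht =>
    cos_pos_of_mem_Ioo ⟨by linarith [pi_pos, ht.1], by linarith [ht.2]⟩
  have hd : ∀ t ∈ Icc 0 x, HasDerivAt (fun t => tan t - (t + t ^ 3 / 3))
      (1 / cos t ^ 2 - (1 + ((3 : ℕ) * t ^ (3 - 1)) / 3)) t := fun t ht =>
    (hasDerivAt_tan (hcos t ht).ne').sub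
      ((hasDerivAt_id t).add ((hasDerivAt_pow 3 t).div_const 3))
  have hmono : MonotoneOn (fun t => tan t - (t + t ^ 3 / 3)) (Icc 0 x) := by
    refine monotoneOn_of_deriv_nonneg (convex_Icc _ _)
      (fun t ht => (hd t ht).continuousAt.continuousWithinAt)
      (fun t ht => (hd t (interior_subset ht)).differentiableAt.differentiableWithinAt)
      fun t ht => ?_
    have ht := interior_subset ht
    have hsq : 1 / cos t ^ 2 = 1 + tan t ^ 2 := by
      rw [← inv_one_add_tan_sq (hcos t ht).ne', one_div, inv_inv]
    have htan := le_tan ht.1 (ht.2.trans_lt h1)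
    rw [(hd t ht).deriv, hsq]
    norm_num
    nlinarith [ht.1]
  have := hmono (left_mem_Icc.2 h0) (right_mem_Icc.2 h0) h0
  simp only [tan_zero] at this
  linarith

lemma log_cos_le {x : ℝ} (h0 : 0 ≤ x) (h1 : x < π / 2) :
    log (cos x) ≤ -(x ^ 2 / 2) - x ^ 4 / 12 := by
  have hcos : ∀ t ∈ Icc 0 x, 0 < cos t := fun t ht =>
    cos_pos_of_mem_Ioo ⟨by linarith [pi_pos, ht.1], by linarith [ht.2]⟩
  have hd : ∀ t ∈ Icc 0 x, HasDerivAt (fun t => log (cos t) + t ^ 2 / 2 + t ^ 4 / 12)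
      (-sin t / cos t + ((2 : ℕ) * t ^ (2 - 1)) / 2 + ((4 : ℕ) * t ^ (4 - 1)) / 12) t := fun t ht =>
    (((hasDerivAt_cos t).log (hcos t ht).ne').add ((hasDerivAt_pow 2 t).div_const 2)).add
      ((hasDerivAt_pow 4 t).div_const 12)
  have hanti : AntitoneOn (fun t => log (cos t) + t ^ 2 / 2 + t ^ 4 / 12) (Icc 0 x) := by
    refine antitoneOn_of_deriv_nonpos (convex_Icc _ _)
      (fun t ht => (hd t ht).continuousAt.continuousWithinAt)
      (fun t ht => (hd t (interior_subset ht)).differentiableAt.differentiableWithinAt)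
      fun t ht => ?_
    have ht := interior_subset ht
    have h := add_cube_div_three_le_tan ht.1 (ht.2.trans_lt h1)
    rw [tan_eq_sin_div_cos] at h
    rw [(hd t ht).deriv, neg_div]
    norm_num
    linarith
  have := hanti (left_mem_Icc.2 h0) (right_mem_Icc.2 h0) h0
  norm_num at this
  linarith

section Branches

variable {P N : ℝ → ℝ}

lemma maxLog_add_logSin {θ : ℝ} (h : 0 < cos θ) :
    maxLog + logSin (π / 2 - θ) = 0.15325 + log (cos θ) := by
  rw [maxLog, logSin, sin_pi_div_two_sub, log_mul (by positivity) h.ne']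
  ring

lemma halfAngle_maxLog :
    halfAngle P maxLog = ∫ θ in 0..(π / 6), speed P (maxLog + logSin (π / 2 - θ)) := by
  rw [halfAngle, intervalIntegral.integral_comp_sub_left (fun ψ => speed P (maxLog + logSin ψ))]
  congr 1 <;> ring

lemma IsNegBranch.intervalIntegrable_speed_cos (hP : IsNegBranch P) :
    IntervalIntegrable (fun θ => speed P (maxLog + logSin (π / 2 - θ))) volume 0 (π / 6) := by
  have h := (hP.intervalIntegrable_speed_logSin maxLog_pos.le).comp_sub_left (π / 2)
  rw [sub_self, show π / 2 - π / 3 = π / 6 by ring] at h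
  exact h.symm

lemma maxLog_add_logSin_pos {θ : ℝ} (hθ : θ ∈ Icc 0 (π / 6)) :
    0 < maxLog + logSin (π / 2 - θ) := by
  have h := chord_le_logSin (ψ := π / 2 - θ) ⟨by linarith [hθ.2], by linarith [hθ.1]⟩
  have h2 := mul_nonneg chordSlope_pos.le (by linarith [hθ.2] : 0 ≤ π / 2 - θ - π / 3)
  linarith [maxLog_pos]

lemma le_integral_speed (hP : IsNegBranch P) {a b d l : ℝ} (ha : 0 ≤ a) (hab : a ≤ b)
    (hb : b ≤ π / 6) (hd : 0 < d) (hd1 : d < 1) (hl : 1 - d ≤ exp l) :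
    (b - a) * (1 / d + 2 * (1 - d) / d ^ 3 * ((-d - l) / 2 - 0.15325)) +
      2 * (1 - d) / d ^ 3 * ((b ^ 3 - a ^ 3) / 6 + (b ^ 5 - a ^ 5) / 60) ≤
    ∫ θ in a..b, speed P (maxLog + logSin (π / 2 - θ)) := by
  set B := 2 * (1 - d) / d ^ 3 with hB
  have hB0 : 0 ≤ B := by
    have : 0 ≤ 1 - d := by linarith
    positivity
  have hlog : log (1 - d) ≤ l := (log_le_iff_le_exp (by linarith)).2 hl
  have hInt : IntervalIntegrable (fun θ => speed P (maxLog + logSin (π / 2 - θ))) volume a b := by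
    refine hP.intervalIntegrable_speed_cos.mono_set ?_
    rw [uIcc_of_le hab, uIcc_of_le (by linarith)]
    exact Icc_subset_Icc ha hb
  have key := intervalIntegral.integral_mono_on (μ := volume) hab
    (f := fun θ => 1 / d + B * ((-d - l) / 2 - 0.15325) + B * (θ ^ 2 / 2 + θ ^ 4 / 12))
    (Continuous.intervalIntegrable (by fun_prop) _ _) hInt fun θ hθ => by
      have h0 : 0 ≤ θ := ha.trans hθ.1
      have h1 : θ ≤ π / 6 := hθ.2.trans hb
      have hπ := pi_pos
      have h2 := hP.tangent_le_speed hd hd1 (maxLog_add_logSin_pos ⟨h0, h1⟩)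
      refine le_trans ?_ h2
      rw [maxLog_add_logSin (cos_pos_of_mem_Ioo ⟨by linarith, by linarith⟩), ← hB, add_assoc,
        ← mul_add]
      have h3 := log_cos_le h0 (by linarith)
      gcongr
      linarith
  refine le_of_eq_of_le ?_ key
  rw [intervalIntegral.integral_add intervalIntegrable_const
      (Continuous.intervalIntegrable (by fun_prop) _ _),
    intervalIntegral.integral_const, intervalIntegral.integral_const_mul,
    intervalIntegral.integral_add (Continuous.intervalIntegrable (by fun_prop) _ _)
      (Continuous.intervalIntegrable (by fun_prop) _ _),
    intervalIntegral.integral_div, intervalIntegral.integral_div, integral_pow, integral_pow,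
    smul_eq_mul]
  push_cast
  ring

lemma le_halfAngle_maxLog (hP : IsNegBranch P) : 1.09 ≤ halfAngle P maxLog := by
  have hπ : 0.5235 ≤ π / 6 := by linarith [pi_gt_d6]
  have hInt : ∀ {a b : ℝ}, 0 ≤ a → a ≤ b → b ≤ π / 6 →
      IntervalIntegrable (fun θ => speed P (maxLog + logSin (π / 2 - θ))) volume a b := by
    intro a b ha hab hb
    refine hP.intervalIntegrable_speed_cos.mono_set ?_
    rw [uIcc_of_le hab, uIcc_of_le (by linarith)]
    exact Icc_subset_Icc ha hb
  have h1 := le_integral_speed hP (a := 0) (b := 0.325) (d := 0.57) (l := -0.8439)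
    (by norm_num) (by norm_num) (by linarith) (by norm_num) (by norm_num)
    (le_exp_neg_of_mul_taylor (by norm_num) (by norm_num) (by norm_num) (by norm_num))
  have h2 := le_integral_speed hP (a := 0.325) (b := 0.45) (d := 0.45) (l := -0.5978)
    (by norm_num) (by norm_num) (by linarith) (by norm_num) (by norm_num)
    (le_exp_neg_of_mul_taylor (by norm_num) (by norm_num) (by norm_num) (by norm_num))
  have h3 := le_integral_speed hP (a := 0.45) (b := 0.5) (d := 0.33) (l := -0.4004)
    (by norm_num) (by norm_num) (by linarith) (by norm_num) (by norm_num)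
    (le_exp_neg_of_mul_taylor (by norm_num) (by norm_num) (by norm_num) (by norm_num))
  have h4 := le_integral_speed hP (a := 0.5) (b := 0.5235) (d := 0.24) (l := -0.2744)
    (by norm_num) (by norm_num) (by linarith) (by norm_num) (by norm_num)
    (le_exp_neg_of_mul_taylor (by norm_num) (by norm_num) (by norm_num) (by norm_num))
  have h5 : 0 ≤ ∫ θ in 0.5235..(π / 6), speed P (maxLog + logSin (π / 2 - θ)) :=
    intervalIntegral.integral_nonneg hπ fun θ hθ => hP.speed_nonneg
      (maxLog_add_logSin_pos ⟨by linarith [hθ.1], hθ.2⟩).le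
  rw [halfAngle_maxLog,
    ← intervalIntegral.integral_add_adjacent_intervals (b := 0.5235)
      (hInt le_rfl (by norm_num) hπ) (hInt (by norm_num) hπ le_rfl),
    ← intervalIntegral.integral_add_adjacent_intervals (b := 0.5)
      (hInt le_rfl (by norm_num) (by linarith)) (hInt (by norm_num) (by norm_num) hπ),
    ← intervalIntegral.integral_add_adjacent_intervals (b := 0.45)
      (hInt le_rfl (by norm_num) (by linarith)) (hInt (by norm_num) (by norm_num) (by linarith)),
    ← intervalIntegral.integral_add_adjacent_intervals (b := 0.325)
      (hInt le_rfl (by norm_num) (by linarith)) (hInt (by norm_num) (by norm_num) (by linarith))]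
  norm_num at h1 h2 h3 h4 h5 ⊢
  linarith

lemma lt_totalAngle_maxLog (hP : IsNegBranch P) (hN : IsPosBranch N) :
    π < totalAngle P N maxLog := by
  have h1 := le_halfAngle_maxLog hP
  have h2 := le_arcAngle hP hN maxLog_pos.le exp_two_maxLog_le
  have h3 := hP.apply_maxLog_le
  have h4 := hN.le_apply_maxLog
  rw [totalAngle]
  linarith [pi_lt_d6]

end Branches

lemma K_exp (s : ℝ) : K (exp s) = exp (logK s) := by
  rw [K, logK, exp_sub, ← exp_nat_mul]
  norm_num

lemma log_K {R : ℝ} (hR : 0 < R) : logK (log R) = log (K R) := by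
  rw [← log_exp (logK (log R)), ← K_exp, exp_log hR]

lemma isNegBranch_log {Rm : ℝ → ℝ} (hRm : ∀ x : ℝ, 1 < x → 0 < Rm x ∧ Rm x < 1 ∧ K (Rm x) = x)
    (hRm1 : Rm 1 = 1) : IsNegBranch fun y => log (Rm (exp y)) := by
  intro y hy
  rcases hy.eq_or_lt with rfl | hy
  · simp [hRm1, logK_zero]
  · obtain ⟨h0, h1, h⟩ := hRm _ (one_lt_exp_iff.2 hy)
    exact ⟨log_nonpos h0.le h1.le, by rw [log_K h0, h, log_exp]⟩

lemma isPosBranch_log {Rp : ℝ → ℝ} (hRp : ∀ x : ℝ, 1 < x → 1 < Rp x ∧ K (Rp x) = x)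
    (hRp1 : Rp 1 = 1) : IsPosBranch fun y => log (Rp (exp y)) := by
  intro y hy
  rcases hy.eq_or_lt with rfl | hy
  · simp [hRp1, logK_zero]
  · obtain ⟨h1, h⟩ := hRp _ (one_lt_exp_iff.2 hy)
    exact ⟨log_nonneg h1.le, by rw [log_K (by linarith), h, log_exp]⟩

lemma integral_eq_two_mul_halfAngle {Rm : ℝ → ℝ} (hpos : ∀ y, 0 ≤ y → 0 < Rm (exp y))
    (hP : IsNegBranch fun y => log (Rm (exp y))) {x : ℝ} (hx : 0 ≤ x) :
    ∫ ψ in (π / 3)..(2 * π / 3), (1 - (Rm (2 / √3 * exp x * sin ψ)) ^ 2)⁻¹ =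
      2 * halfAngle (fun y => log (Rm (exp y))) x := by
  have hπ := pi_pos
  set P := fun y => log (Rm (exp y)) with hPdef
  have hInt := hP.intervalIntegrable_speed_logSin hx
  have hsymm : ∀ ψ, speed P (x + logSin (π - ψ)) = speed P (x + logSin ψ) := fun ψ => by
    rw [logSin_pi_sub]
  have hInt2 : IntervalIntegrable (fun ψ => speed P (x + logSin ψ)) volume (π / 2)
      (2 * π / 3) := by
    have h := hInt.comp_sub_left π
    simp only [hsymm] at h
    rw [show π - π / 2 = π / 2 by ring, show π - π / 3 = 2 * π / 3 by ring] at h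
    exact h.symm
  have heq : ∫ ψ in (π / 2)..(2 * π / 3), speed P (x + logSin ψ) = halfAngle P x := by
    have h := intervalIntegral.integral_comp_sub_left (fun ψ => speed P (x + logSin ψ))
      (a := π / 2) (b := 2 * π / 3) π
    simp only [hsymm] at h
    rw [h, halfAngle]
    congr 1 <;> ring
  have hcongr : ∫ ψ in (π / 3)..(2 * π / 3), (1 - (Rm (2 / √3 * exp x * sin ψ)) ^ 2)⁻¹ =
      ∫ ψ in (π / 3)..(2 * π / 3), speed P (x + logSin ψ) := by
    refine intervalIntegral.integral_congr fun ψ hψ => ?_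
    rw [uIcc_of_le (by linarith)] at hψ
    have hsin : 0 < sin ψ := sin_pos_of_mem_Ioo ⟨by linarith [hψ.1], by linarith [hψ.2]⟩
    have hnonneg : 0 ≤ logSin ψ := by
      rcases le_total ψ (π / 2) with h | h
      · refine le_trans ?_ (chord_le_logSin ⟨hψ.1, h⟩)
        exact mul_nonneg chordSlope_pos.le (by linarith [hψ.1])
      · rw [← logSin_pi_sub]
        refine le_trans ?_ (chord_le_logSin ⟨by linarith [hψ.2], by linarith⟩)
        exact mul_nonneg chordSlope_pos.le (by linarith [hψ.2])
    have harg : 2 / √3 * exp x * sin ψ = exp (x + logSin ψ) := by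
      rw [exp_add, logSin, exp_log (by positivity)]
      ring
    have hexp : exp (2 * P (x + logSin ψ)) = Rm (exp (x + logSin ψ)) ^ 2 := by
      rw [mul_comm, exp_mul, hPdef, exp_log (hpos _ (by linarith)), rpow_two]
    simp only [harg, speed, hexp]
  rw [hcongr, ← intervalIntegral.integral_add_adjacent_intervals hInt hInt2, heq, ← halfAngle]
  ring

lemma integral_eq_arcAngle {P N : ℝ → ℝ} (hP : IsNegBranch P) (hN : IsPosBranch N) {x : ℝ}
    (hx : 0 ≤ x) :
    ∫ R in (exp (P x))..(exp (N x)), K R / (R * √((2 / √3 * exp x) ^ 2 - (K R) ^ 2)) =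
      arcAngle P N x := by
  have hPN : P x ≤ N x := (hP x hx).1.trans (hN x hx).1
  have hpos : ∀ s ∈ Icc (P x) (N x), 0 < (2 / √3 * exp x) ^ 2 - (K (exp s)) ^ 2 := by
    intro s hs
    have h := logK_le_of_mem_Icc hP hN hx hs
    rw [K_exp, mul_pow, div_pow, sq_sqrt (by norm_num)]
    have h1 : exp (logK s) ^ 2 ≤ exp x ^ 2 := by gcongr
    have h2 : 0 < exp x ^ 2 := by positivity
    linarith
  have hcont : ContinuousOn (fun R => K R / (R * √((2 / √3 * exp x) ^ 2 - (K R) ^ 2)))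
      (exp '' uIcc (P x) (N x)) := by
    have hpos' : ∀ R ∈ exp '' uIcc (P x) (N x), R ≠ 0 := by
      rintro _ ⟨s, -, rfl⟩
      exact (exp_pos s).ne'
    have hK : ContinuousOn K (exp '' uIcc (P x) (N x)) := by
      unfold K
      exact ContinuousOn.div (by fun_prop) continuousOn_id hpos'
    refine hK.div (continuousOn_id.mul (continuousOn_const.sub (hK.pow 2)).sqrt) ?_
    rintro _ ⟨s, hs, rfl⟩
    rw [uIcc_of_le hPN] at hs
    exact mul_ne_zero (exp_pos s).ne' (sqrt_pos.2 (hpos s hs)).ne'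
  rw [← intervalIntegral.integral_comp_mul_deriv' (fun s _ => hasDerivAt_exp s)
    continuous_exp.continuousOn hcont, arcAngle]
  refine intervalIntegral.integral_congr fun s hs => ?_
  rw [uIcc_of_le hPN] at hs
  have h := logK_le_of_mem_Icc hP hN hx hs
  have hs0 := hpos s hs
  have e : (2 / √3 * exp x) ^ 2 - (K (exp s)) ^ 2 =
      K (exp s) ^ 2 * (4 / 3 * exp (2 * (x - logK s)) - 1) := by
    have e1 : exp (2 * (x - logK s)) = exp x ^ 2 / exp (logK s) ^ 2 := by
      rw [mul_sub, exp_sub, ← exp_nat_mul, ← exp_nat_mul]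
      norm_num
    rw [K_exp, mul_pow, div_pow, sq_sqrt (by norm_num), e1]
    field_simp
    ring
  have hK : 0 < K (exp s) := by
    rw [K_exp]
    exact exp_pos _
  have hq : 0 < √(4 / 3 * exp (2 * (x - logK s)) - 1) := by
    have : 1 ≤ exp (2 * (x - logK s)) := one_le_exp (by linarith)
    exact sqrt_pos.2 (by linarith)
  simp only [Function.comp_apply]
  rw [angleDensity_of_nonneg (by linarith), e, sqrt_mul (by positivity), sqrt_sq hK.le]
  field_simp

end

theorem stmt_18 (Rm Rp : ℝ → ℝ)
    (hRm : ∀ x : ℝ, 1 < x → 0 < Rm x ∧ Rm x < 1 ∧ K (Rm x) = x)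
    (hRp : ∀ x : ℝ, 1 < x → 1 < Rp x ∧ K (Rp x) = x)
    (hRm1 : Rm 1 = 1) (hRp1 : Rp 1 = 1) :
    ∃! c : ℝ, c ∈ Set.Icc (2 / Real.sqrt 3) (Real.exp 0.15325) ∧
      (∫ ψ in (π / 3)..(2 * π / 3), (1 - (Rm (c * Real.sin ψ)) ^ 2)⁻¹) +
        3 * (∫ R in (Rm (Real.sqrt 3 / 2 * c))..(Rp (Real.sqrt 3 / 2 * c)),
          K R / (R * Real.sqrt (c ^ 2 - (K R) ^ 2))) = π := by
  have hP := isNegBranch_log hRm hRm1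
  have hN := isPosBranch_log hRp hRp1
  set P := fun y => log (Rm (exp y)) with hPdef
  set N := fun y => log (Rp (exp y)) with hNdef
  have hRm0 : ∀ y, 0 ≤ y → 0 < Rm (exp y) := by
    intro y hy
    rcases hy.eq_or_lt with rfl | hy
    · simp [hRm1]
    · exact (hRm _ (one_lt_exp_iff.2 hy)).1
  have hRp0 : ∀ y, 0 ≤ y → 0 < Rp (exp y) := by
    intro y hy
    rcases hy.eq_or_lt with rfl | hy
    · simp [hRp1]
    · linarith [(hRp _ (one_lt_exp_iff.2 hy)).1]
  have htotal : ∀ x, 0 ≤ x →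
      (∫ ψ in (π / 3)..(2 * π / 3), (1 - (Rm (2 / √3 * exp x * sin ψ)) ^ 2)⁻¹) +
        3 * (∫ R in (Rm (√3 / 2 * (2 / √3 * exp x)))..(Rp (√3 / 2 * (2 / √3 * exp x))),
          K R / (R * √((2 / √3 * exp x) ^ 2 - (K R) ^ 2))) = totalAngle P N x := by
    intro x hx
    have e : √3 / 2 * (2 / √3 * exp x) = exp x := by field_simp
    rw [integral_eq_two_mul_halfAngle hRm0 hP hx, e, totalAngle, ← integral_eq_arcAngle hP hN hx,
      hPdef, hNdef, exp_log (hRm0 x hx), exp_log (hRp0 x hx)]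
  have hcont : ContinuousOn (totalAngle P N) (Set.Icc 0 maxLog) :=
    (continuousOn_totalAngle hP hN).mono Set.Icc_subset_Ici_self
  have hmax : 2 / √3 * exp maxLog = exp 0.15325 := by
    rw [maxLog, exp_sub, exp_log (by positivity)]
    field_simp
  obtain ⟨x, hx, hxπ⟩ := intermediate_value_Icc maxLog_pos.le hcont
    ⟨(totalAngle_zero_lt hP hN).le, (lt_totalAngle_maxLog hP hN).le⟩
  have h23 : 0 < 2 / √3 := by positivity
  refine ⟨2 / √3 * exp x, ⟨⟨?_, ?_⟩, (htotal x hx.1).trans hxπ⟩, ?_⟩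
  · exact le_mul_of_one_le_right h23.le (one_le_exp hx.1)
  · rw [← hmax]
    gcongr
    exact hx.2
  · rintro c ⟨⟨hc1, hc2⟩, hc⟩
    have hc0 : 0 < c := h23.trans_le hc1
    obtain ⟨y, rfl⟩ : ∃ y, 2 / √3 * exp y = c := by
      refine ⟨log (c / (2 / √3)), ?_⟩
      rw [exp_log (by positivity)]
      field_simp
    rw [← hmax, mul_le_mul_iff_right₀ h23, exp_le_exp] at hc2
    rw [le_mul_iff_one_le_right h23, one_le_exp_iff] at hc1
    rw [htotal y hc1] at hc
    rw [(strictMonoOn_totalAngle hP hN).injOn ⟨hc1, hc2⟩ hx (hc.trans hxπ.symm)]
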